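/- arXiv:math/0310149 — 7 statements merged into one kernel-verified Lean document; each statement's English description precedes it below -/
import Mathlib

section
/- Let F₃ = ℤ/3ℤ and let C ⊆ F₃(z)² be the F₃(z)-linear span of the single row vector (z+1, z+2). Then the free distance of C equals 4; that is, 4 is the least element of the set of weights of nonzero codewords of C all of whose components are polynomials. In particular, for every nonzero p ∈ F₃[z], the number of nonzero coefficients of p·(z+1) plus the number of nonzero coefficients of p·(z+2) is at least 4, and this value 4 is attained. -/
open Polynomial

/-- A nonzero polynomial over a domain with a nonzero root has at least two nonzero coefficients. -/
theorem two_le_card_support_of_isRoot {R : Type*} [CommRing R] [IsDomain R] {p : R[X]} {a : R}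
    (hp : p ≠ 0) (ha : a ≠ 0) (h : p.IsRoot a) : 2 ≤ p.support.card := by
  by_contra! hlt
  obtain ⟨n, c, rfl⟩ := card_support_le_one_iff_monomial.1 (Nat.le_of_lt_succ hlt)
  simp_all [IsRoot.def, eval_monomial]

/-- The convolutional code over `F₃(z)` spanned by `(z+1, z+2)` has free distance `4`:
`4` is the least total number of nonzero coefficients of a nonzero codeword all of
whose components are polynomials. -/
theorem free_distance_F3_code :
    IsLeast
      { w : ℕ | ∃ u : Fin 2 → Polynomial (ZMod 3), u ≠ 0 ∧
          (fun i => algebraMap (Polynomial (ZMod 3)) (RatFunc (ZMod 3)) (u i)) ∈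
            Submodule.span (RatFunc (ZMod 3))
              ({fun i => algebraMap (Polynomial (ZMod 3)) (RatFunc (ZMod 3))
                  (![X + 1, X + 2] i)} : Set (Fin 2 → RatFunc (ZMod 3))) ∧
          w = ∑ i, (u i).support.card }
      4 := by
  have h₁ : (X + 1 : (ZMod 3)[X]) ≠ 0 := X_add_C_ne_zero 1
  have h₂ : (X + 2 : (ZMod 3)[X]) ≠ 0 := X_add_C_ne_zero 2
  constructor
  · refine ⟨![X + 1, X + 2], fun h => h₁ (congrFun h 0), Submodule.mem_span_singleton_self _, ?_⟩
    have card_support (c : ZMod 3) (hc : c ≠ 0) : (X + C c).support.card = 2 := by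
      simpa using card_support_binomial (k := 1) (m := 0) one_ne_zero one_ne_zero hc
    have e₁ : (X + 1 : (ZMod 3)[X]).support.card = 2 := card_support 1 (by decide)
    have e₂ : (X + 2 : (ZMod 3)[X]).support.card = 2 := card_support 2 (by decide)
    simp [Fin.sum_univ_two, e₁, e₂]
  · rintro w ⟨u, hu, hmem, rfl⟩
    obtain ⟨f, hf⟩ := Submodule.mem_span_singleton.1 hmem
    have f₀ := congrFun hf 0
    have f₁ := congrFun hf 1
    simp only [Pi.smul_apply, smul_eq_mul, Matrix.cons_val_zero, Matrix.cons_val_one] at f₀ f₁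
    have key : (X + 2) * u 0 = (X + 1) * u 1 := by
      apply RatFunc.algebraMap_injective (ZMod 3)
      rw [map_mul, map_mul, ← f₀, ← f₁]
      ring
    have r₀ : (u 0).IsRoot (-1) := by
      have h := congrArg (eval (-1)) key
      have h2 : (-1 + 2 : ZMod 3) ≠ 0 := by decide
      simpa [h2] using h
    have r₁ : (u 1).IsRoot 1 := by
      have h := congrArg (eval 1) key
      have h3 : (1 + 2 : ZMod 3) = 0 := by decide
      have h2 : (1 + 1 : ZMod 3) ≠ 0 := by decide
      simpa [h2, h3] using h.symm
    have iff_zero : u 0 = 0 ↔ u 1 = 0 := by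
      constructor <;> intro h <;> simpa [h, h₁, h₂] using key
    have n₀ : u 0 ≠ 0 := fun h => hu <| funext <| Fin.forall_fin_two.2 ⟨h, iff_zero.1 h⟩
    have n₁ : u 1 ≠ 0 := mt iff_zero.2 n₀
    rw [Fin.sum_univ_two]
    exact add_le_add (two_le_card_support_of_isRoot n₀ (by decide) r₀)
      (two_le_card_support_of_isRoot n₁ one_ne_zero r₁)
end

section
/- Let F₄ be the field with four elements and fix α ∈ F₄ with α² + α + 1 = 0. Let C ⊆ F₄(z)³ be the F₄(z)-linear span of the two row vectors (1, 1, 1) and (z+1, αz+α², α²z+α). Then the free distance of C equals 3; that is, 3 is the least element of the set of weights of nonzero codewords of C all of whose components are polynomials. -/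
open Polynomial

theorem Polynomial.eq_zero_of_card_support_le_one_of_eval_eq_zero {F : Type*} [Field F]
    {p : F[X]} {x : F} (hx : x ≠ 0) (hp : p.support.card ≤ 1) (h : p.eval x = 0) : p = 0 := by
  obtain ⟨n, a, rfl⟩ := card_support_le_one_iff_monomial.mp hp
  simpa [hx] using h

/-- Two polynomials of total weight at most two cannot satisfy a nontrivial relation
with linear coefficients having distinct nonzero roots. -/
theorem Polynomial.eq_zero_of_linear_relation {F : Type*} [Field F] {p q : F[X]} {x y c d : F}
    (hx : x ≠ 0) (hy : y ≠ 0) (hxy : x ≠ y) (hc : c ≠ 0) (hd : d ≠ 0)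
    (hcard : p.support.card + q.support.card ≤ 2)
    (h : C c * (X - C x) * p + C d * (X - C y) * q = 0) : p = 0 ∧ q = 0 := by
  have hq : q.eval x = 0 := by
    have := congrArg (eval x) h
    simpa [hd, sub_ne_zero.mpr hxy] using this
  have hp : p.eval y = 0 := by
    have := congrArg (eval y) h
    simpa [hc, sub_ne_zero.mpr hxy.symm] using this
  have hpq : p = 0 ∨ q = 0 := by
    rcases le_or_gt p.support.card 1 with h1 | h1
    · exact Or.inl (eq_zero_of_card_support_le_one_of_eval_eq_zero hy h1 hp)
    · exact Or.inr (eq_zero_of_card_support_le_one_of_eval_eq_zero hx (by omega) hq)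
  rcases hpq with rfl | rfl
  · simpa [hd, X_sub_C_ne_zero] using h
  · simpa [hc, X_sub_C_ne_zero] using h

/-- A nonzero triple satisfying a parity check with linear entries having distinct nonzero roots
has weight at least three. -/
theorem Polynomial.three_le_weight_of_parity_check {F : Type*} [Field F] {u : Fin 3 → F[X]}
    {x c : Fin 3 → F} (hx : ∀ i, x i ≠ 0) (hinj : Function.Injective x) (hc : ∀ i, c i ≠ 0)
    (h : ∑ i, C (c i) * (X - C (x i)) * u i = 0) (hu : u ≠ 0) :
    3 ≤ ∑ i, (u i).support.card := by
  by_contra! hlt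
  rw [Fin.sum_univ_three] at h hlt
  have hzero : u 0 = 0 ∨ u 1 = 0 ∨ u 2 = 0 := by
    simp only [← support_eq_empty, ← Finset.card_eq_zero]
    omega
  have hne (i j : Fin 3) (hij : i ≠ j) : x i ≠ x j := hinj.ne hij
  have hall : u 0 = 0 ∧ u 1 = 0 ∧ u 2 = 0 := by
    rcases hzero with h0 | h0 | h0
    · exact ⟨h0, eq_zero_of_linear_relation (hx 1) (hx 2) (hne 1 2 (by decide)) (hc 1) (hc 2)
        (by omega) (by simpa [h0] using h)⟩
    · have := eq_zero_of_linear_relation (p := u 0) (q := u 2) (hx 0) (hx 2) (hne 0 2 (by decide))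
        (hc 0) (hc 2) (by omega) (by simpa [h0] using h)
      exact ⟨this.1, h0, this.2⟩
    · have := eq_zero_of_linear_relation (p := u 0) (q := u 1) (hx 0) (hx 1) (hne 0 1 (by decide))
        (hc 0) (hc 1) (by omega) (by simpa [h0] using h)
      exact ⟨this.1, this.2, h0⟩
  apply hu
  ext1 i
  fin_cases i <;> simp [hall]

/-- Let `F₄` be the field with four elements and `α ∈ F₄` with `α² + α + 1 = 0`.
The convolutional code over `F₄(z)` spanned by `(1, 1, 1)` and
`(z+1, αz+α², α²z+α)` has free distance `3`. -/
theorem free_distance_F4_code_two_rows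
    (α : GaloisField 2 2) (hα : α ^ 2 + α + 1 = 0) :
    IsLeast
      { w : ℕ | ∃ u : Fin 3 → Polynomial (GaloisField 2 2), u ≠ 0 ∧
          (fun i => algebraMap (Polynomial (GaloisField 2 2)) (RatFunc (GaloisField 2 2)) (u i)) ∈
            Submodule.span (RatFunc (GaloisField 2 2))
              ({fun i => algebraMap (Polynomial (GaloisField 2 2)) (RatFunc (GaloisField 2 2))
                  (![1, 1, 1] i),
                fun i => algebraMap (Polynomial (GaloisField 2 2)) (RatFunc (GaloisField 2 2))
                  (![X + 1, C α * X + C (α ^ 2), C (α ^ 2) * X + C α] i)} :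
                Set (Fin 3 → RatFunc (GaloisField 2 2))) ∧
          w = ∑ i, (u i).support.card }
      3 := by
  have h2 : (2 : GaloisField 2 2) = 0 := CharTwo.two_eq_zero
  have hα0 : α ≠ 0 := by rintro rfl; simp at hα
  have hα1 : α ≠ 1 := by
    rintro rfl
    exact one_ne_zero (α := GaloisField 2 2) (by linear_combination hα - h2)
  have hsq : α ^ 2 = α + 1 := by linear_combination hα - (α + 1) * h2
  constructor
  · refine ⟨![1, 1, 1], fun h => one_ne_zero (congrFun h 0),
      Submodule.subset_span (Set.mem_insert _ _), ?_⟩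
    have h1 : (1 : (GaloisField 2 2)[X]).support.card = 1 := by
      rw [← C_1, support_C one_ne_zero, Finset.card_singleton]
    simp [Fin.sum_univ_three, h1]
  · rintro w ⟨u, hu, hmem, rfl⟩
    obtain ⟨s, t, hst⟩ := Submodule.mem_span_pair.mp hmem
    have e0 := congrFun hst 0
    have e1 := congrFun hst 1
    have e2 := congrFun hst 2
    simp only [Pi.add_apply, Pi.smul_apply, smul_eq_mul, Matrix.cons_val] at e0 e1 e2
    have hP : (C α ^ 2 + C α + 1 : (GaloisField 2 2)[X]) = 0 := by
      simpa using congrArg C hα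
    refine three_le_weight_of_parity_check (x := ![1, α, α ^ 2]) (c := ![1, α, α ^ 2])
      ?_ ?_ ?_ ?_ hu
    · intro i; fin_cases i <;> simp [hα0]
    · have hα2 : α ^ 2 ≠ 1 := by simpa [hsq] using hα0
      have hα3 : α ^ 2 ≠ α := by simp [hsq]
      intro i j hij
      fin_cases i <;> fin_cases j <;> simp_all [eq_comm]
    · intro i; fin_cases i <;> simp [hα0]
    · apply RatFunc.algebraMap_injective (GaloisField 2 2)
      have hA := congrArg (algebraMap (GaloisField 2 2)[X] (RatFunc (GaloisField 2 2))) hP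
      simp only [Fin.sum_univ_three, Matrix.cons_val, map_add, map_sub, map_mul, map_one,
        map_zero, map_pow] at hA e0 e1 e2 ⊢
      rw [← e0, ← e1, ← e2]
      generalize algebraMap (GaloisField 2 2)[X] (RatFunc (GaloisField 2 2)) (C α) = a at *
      generalize algebraMap (GaloisField 2 2)[X] (RatFunc (GaloisField 2 2)) X = z at *
      linear_combination (s * (z - (a ^ 2 - a + 1)) + t * ((a ^ 2 - a + 1) * z ^ 2
        + a ^ 3 * (1 - a) * z - (a ^ 3 - a + 1))) * hA
end

section
/- Let F₄ be the field with four elements and fix α ∈ F₄ with α² + α + 1 = 0. Let C ⊆ F₄(z)³ be the F₄(z)-linear span of the single row vector (z+1, z+α, z+α²). Then the free distance of C equals 6; that is, 6 is the least element of the set of weights of nonzero codewords of C all of whose components are polynomials. In particular, for every nonzero p ∈ F₄[z], the total number of nonzero coefficients of p·(z+1), p·(z+α) and p·(z+α²) is at least 6, and this value 6 is attained. -/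
open Polynomial

/-- A nonzero multiple of `X + C c` with `c ≠ 0` has at least two nonzero coefficients. -/
theorem Polynomial.two_le_card_support_mul_X_add_C {R : Type*} [CommRing R] [IsDomain R]
    {p : R[X]} {c : R} (hp : p ≠ 0) (hc : c ≠ 0) :
    2 ≤ (p * (X + C c)).support.card := by
  have hq : (X + C c : R[X]) ≠ 0 := X_add_C_ne_zero c
  have hpq : p * (X + C c) ≠ 0 := mul_ne_zero hp hq
  have hlt : (p * (X + C c)).natTrailingDegree < (p * (X + C c)).natDegree := by
    have ht : (X + C c : R[X]).natTrailingDegree = 0 :=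
      natTrailingDegree_eq_zero.mpr (Or.inr (by simpa using hc))
    rw [natTrailingDegree_mul hp hq, natDegree_mul hp hq, ht, natDegree_X_add_C]
    have := p.natTrailingDegree_le_natDegree
    omega
  rw [← Finset.card_pair hlt.ne]
  refine Finset.card_le_card ?_
  rw [Finset.insert_subset_iff, Finset.singleton_subset_iff]
  exact ⟨natTrailingDegree_mem_support_of_nonzero hpq, natDegree_mem_support_of_nonzero hpq⟩

/-- The polynomial `X + C c` with `c ≠ 0` has exactly two nonzero coefficients. -/
theorem Polynomial.card_support_X_add_C {R : Type*} [Semiring R] [Nontrivial R]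
    {c : R} (hc : c ≠ 0) : (X + C c : R[X]).support.card = 2 := by
  have h := card_support_binomial (R := R) (k := 1) (m := 0) one_ne_zero one_ne_zero hc
  simpa using h

/-- If two entries of a polynomial vector `g` differ by a unit, every polynomial vector in the
`K(z)`-span of `g` is a polynomial multiple of `g`. -/
theorem Polynomial.exists_eq_mul_of_mem_span_singleton {K ι : Type*} [Field K]
    {g u : ι → K[X]} {i j : ι} {d : K} (hd : d ≠ 0) (hg : g i - g j = C d)
    (hu : (fun k => algebraMap K[X] (RatFunc K) (u k)) ∈
      Submodule.span (RatFunc K) {fun k => algebraMap K[X] (RatFunc K) (g k)}) :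
    ∃ p : K[X], ∀ k, u k = p * g k := by
  obtain ⟨f, hf⟩ := Submodule.mem_span_singleton.mp hu
  have hfk (k : ι) : f * algebraMap K[X] (RatFunc K) (g k) = algebraMap _ _ (u k) := congrFun hf k
  have hfp : f = algebraMap K[X] (RatFunc K) ((u i - u j) * C d⁻¹) := by
    have hunit : algebraMap K[X] (RatFunc K) (C d) * algebraMap K[X] (RatFunc K) (C d⁻¹) = 1 := by
      rw [← map_mul, ← C_mul, mul_inv_cancel₀ hd, C_1, map_one]
    rw [map_mul, map_sub, ← hfk, ← hfk, ← mul_sub, ← map_sub, hg, mul_assoc, hunit, mul_one]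
  refine ⟨(u i - u j) * C d⁻¹, fun k => RatFunc.algebraMap_injective K ?_⟩
  rw [map_mul, ← hfp, hfk]

/-- Let `F₄` be the field with four elements and `α ∈ F₄` with `α² + α + 1 = 0`.
The convolutional code over `F₄(z)` spanned by `(z+1, z+α, z+α²)` has free
distance `6`. -/
theorem free_distance_F4_code_one_row
    (α : GaloisField 2 2) (hα : α ^ 2 + α + 1 = 0) :
    IsLeast
      { w : ℕ | ∃ u : Fin 3 → Polynomial (GaloisField 2 2), u ≠ 0 ∧
          (fun i => algebraMap (Polynomial (GaloisField 2 2)) (RatFunc (GaloisField 2 2)) (u i)) ∈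
            Submodule.span (RatFunc (GaloisField 2 2))
              ({fun i => algebraMap (Polynomial (GaloisField 2 2)) (RatFunc (GaloisField 2 2))
                  (![X + 1, X + C α, X + C (α ^ 2)] i)} :
                Set (Fin 3 → RatFunc (GaloisField 2 2))) ∧
          w = ∑ i, (u i).support.card }
      6 := by
  have hα0 : α ≠ 0 := by
    rintro rfl
    simp at hα
  have hα1 : α - 1 ≠ 0 := by
    intro h
    have h2 : (2 : GaloisField 2 2) = 0 := CharTwo.two_eq_zero
    exact one_ne_zero (α := GaloisField 2 2)
      (by linear_combination hα - (α + 2) * h - h2)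
  have hα2 : α ^ 2 ≠ 0 := pow_ne_zero 2 hα0
  constructor
  · refine ⟨![X + 1, X + C α, X + C (α ^ 2)], fun h => ?_, Submodule.mem_span_singleton_self _, ?_⟩
    · exact X_add_C_ne_zero α (congrFun h 1)
    · have h1 := card_support_X_add_C (one_ne_zero (α := GaloisField 2 2))
      rw [C_1] at h1
      simp only [Fin.sum_univ_three, Matrix.cons_val]
      rw [h1, card_support_X_add_C hα0, card_support_X_add_C hα2]
  · rintro w ⟨u, hu0, hu, rfl⟩
    obtain ⟨p, hp⟩ := exists_eq_mul_of_mem_span_singleton (i := 1) (j := 0) hα1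
      (by simp) hu
    have hp0 : p ≠ 0 := by
      rintro rfl
      exact hu0 (funext fun k => by simp [hp k])
    have h0 := two_le_card_support_mul_X_add_C hp0 (one_ne_zero (α := GaloisField 2 2))
    have h1 := two_le_card_support_mul_X_add_C hp0 hα0
    have h2 := two_le_card_support_mul_X_add_C hp0 hα2
    rw [C_1] at h0
    simp only [Fin.sum_univ_three, hp, Matrix.cons_val]
    omega
end

section
/- Let F₅ = ℤ/5ℤ and let C ⊆ F₅(z)³ be the F₅(z)-linear span of the single row vector ((z+1)², (z+2)², (z+4)²). Then the free distance of C equals 9; that is, 9 is the least element of the set of weights of nonzero codewords of C all of whose components are polynomials. In particular, for every nonzero p ∈ F₅[z], the total number of nonzero coefficients of p·(z+1)², p·(z+2)² and p·(z+4)² is at least 9, and this value 9 is attained. -/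
open Polynomial

instance : Fact (Nat.Prime 5) := ⟨by norm_num⟩

/-- The number of nonzero output symbols of the encoder in state `(s, t)` on input `x`. -/
def outputWeight (s t x : ZMod 5) : ℕ :=
  (if s + 2 * t + 1 * x ≠ 0 then 1 else 0) + (if s + 4 * t + 4 * x ≠ 0 then 1 else 0) +
    (if s + 3 * t + 1 * x ≠ 0 then 1 else 0)

/-- The minimal output weight of a path leading from the state `(s, t)` to the zero state. -/
def stateDistance (s t : ZMod 5) : ℕ :=
  if s = 0 ∧ t = 0 then 0 else if s = 0 ∨ s + t = 0 then 6 else if t = 0 then 3 else 5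

lemma stateDistance_le (s t x : ZMod 5) :
    stateDistance s t ≤ outputWeight s t x + stateDistance t x := by
  revert s t x
  decide

lemma nine_le_outputWeight_add (x : ZMod 5) (h : x ≠ 0) :
    9 ≤ outputWeight 0 0 x + stateDistance 0 x := by
  revert x
  decide

lemma nine_le_sum_outputWeight_add (b : ℕ → ZMod 5) (h0 : b 0 = 0) (h1 : b 1 = 0) (N : ℕ) :
    (∀ n < N + 2, b n = 0) ∨
      9 ≤ ∑ n ∈ Finset.range N, outputWeight (b n) (b (n + 1)) (b (n + 2)) +
        stateDistance (b N) (b (N + 1)) := by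
  induction N with
  | zero =>
    left
    intro n hn
    interval_cases n <;> assumption
  | succ N ih =>
    rw [Finset.sum_range_succ, show N + 1 + 1 = N + 2 from rfl]
    rcases ih with ih | ih
    · by_cases hx : b (N + 2) = 0
      · left
        intro n hn
        rcases Nat.lt_succ_iff_lt_or_eq.mp hn with hn | rfl
        · exact ih n hn
        · exact hx
      · right
        have := nine_le_outputWeight_add _ hx
        rw [ih N (by omega), ih (N + 1) (by omega)]
        omega
    · right
      have := stateDistance_le (b N) (b (N + 1)) (b (N + 2))
      omega

lemma card_support_eq_sum_range {R : Type*} [Semiring R] [DecidableEq R] (p : R[X]) {N : ℕ}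
    (h : p.natDegree < N) :
    p.support.card = ∑ n ∈ Finset.range N, if p.coeff n ≠ 0 then 1 else 0 := by
  rw [← Finset.card_filter]
  congr 1
  ext n
  simp only [mem_support_iff, Finset.mem_filter, Finset.mem_range]
  exact ⟨fun hn => ⟨(le_natDegree_of_ne_zero hn).trans_lt h, hn⟩, fun hn => hn.2⟩

lemma coeff_mul_monic_quadratic {R : Type*} [CommRing R] (p : R[X]) (c d : R) (n : ℕ) :
    (p * (X ^ 2 + C c * X + C d)).coeff n =
      (p * X ^ 2).coeff n + c * (p * X ^ 2).coeff (n + 1) + d * (p * X ^ 2).coeff (n + 2) := by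
  have h : p * (X ^ 2 + C c * X + C d) = p * X ^ 2 + C c * (p * X) + C d * p := by ring
  have h' : p * X ^ 2 = p * X * X := by ring
  rw [h, coeff_add, coeff_add, coeff_C_mul, coeff_C_mul, coeff_mul_X_pow p 2 n, h', coeff_mul_X]

lemma generator_eq :
    (![(X + 1) ^ 2, (X + 2) ^ 2, (X + 4) ^ 2] : Fin 3 → (ZMod 5)[X]) =
      ![X ^ 2 + C 2 * X + C 1, X ^ 2 + C 4 * X + C 4, X ^ 2 + C 3 * X + C 1] := by
  have h5 : (5 : (ZMod 5)[X]) = 0 := by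
    rw [← map_ofNat C 5]
    exact congrArg C (by decide) |>.trans C_0
  have h2 : (C 2 : (ZMod 5)[X]) = 2 := map_ofNat C 2
  have h3 : (C 3 : (ZMod 5)[X]) = 3 := map_ofNat C 3
  have h4 : (C 4 : (ZMod 5)[X]) = 4 := map_ofNat C 4
  rw [h2, h3, h4, C_1]
  congr 1
  · ring
  · congr 1
    · ring
    · congr 1
      linear_combination (X + 3) * h5

/-- Every nonzero polynomial multiple of the generator has weight at least `9`. -/
lemma nine_le_weight_mul (p : (ZMod 5)[X]) (hp : p ≠ 0) :
    9 ≤ ∑ i, (p * ![(X + 1) ^ 2, (X + 2) ^ 2, (X + 4) ^ 2] i).support.card := by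
  rw [generator_eq, Fin.sum_univ_three]
  simp only [Matrix.cons_val]
  obtain ⟨N, hN⟩ : ∃ N, ∀ q ∈ ({p * X ^ 2, p * (X ^ 2 + C 2 * X + C 1),
      p * (X ^ 2 + C 4 * X + C 4), p * (X ^ 2 + C 3 * X + C 1)} : Finset (ZMod 5)[X]),
      q.natDegree < N :=
    ⟨_, fun q hq => Nat.lt_succ_of_le (Finset.le_sup (f := natDegree) hq)⟩
  simp only [Finset.mem_insert, Finset.mem_singleton, forall_eq_or_imp, forall_eq] at hN
  obtain ⟨hb, h1, h2, h3⟩ := hN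
  rw [card_support_eq_sum_range _ h1, card_support_eq_sum_range _ h2,
    card_support_eq_sum_range _ h3, ← Finset.sum_add_distrib, ← Finset.sum_add_distrib]
  simp only [coeff_mul_monic_quadratic]
  have key := nine_le_sum_outputWeight_add (p * X ^ 2).coeff
    (by simp) (by simp [coeff_mul_X_pow']) N
  have hbN : ∀ n, N ≤ n → (p * X ^ 2).coeff n = 0 := fun n hn =>
    coeff_eq_zero_of_natDegree_lt (hb.trans_le hn)
  rcases key with key | key
  · refine absurd ?_ hp
    have : p * X ^ 2 = 0 := by
      ext n
      rcases lt_or_ge n N with hn | hn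
      · exact key n (by omega)
      · exact hbN n hn
    exact (mul_eq_zero.mp this).resolve_right (pow_ne_zero 2 X_ne_zero)
  · rw [hbN N le_rfl, hbN (N + 1) (by omega)] at key
    exact key

lemma exists_eq_mul_of_isCoprime {R K ι : Type*} [CommRing R] [Field K] [Algebra R K]
    [FaithfulSMul R K] (g u : ι → R) {i j : ι} (hg : IsCoprime (g i) (g j)) {r : K}
    (h : ∀ k, r * algebraMap R K (g k) = algebraMap R K (u k)) :
    ∃ p : R, ∀ k, u k = p * g k := by
  obtain ⟨a, b, hab⟩ := hg
  have hr : r = algebraMap R K (a * u i + b * u j) := by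
    have := congrArg (algebraMap R K) hab
    simp only [map_add, map_mul, map_one] at this ⊢
    rw [← h, ← h]
    linear_combination (-r) * this
  refine ⟨a * u i + b * u j, fun k => FaithfulSMul.algebraMap_injective R K ?_⟩
  rw [map_mul, ← hr, h]

lemma card_support_monic_quadratic {c d : ZMod 5} (hc : c ≠ 0) (hd : d ≠ 0) :
    (X ^ 2 + C c * X + C d).support.card = 3 := by
  rw [← card_support_trinomial (show 0 < 1 by simp) (show 1 < 2 by simp) hd hc one_ne_zero]
  congr 2
  simp only [pow_zero, mul_one, pow_one, C_1, one_mul]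
  ring

/-- The convolutional code over `F₅(z)` spanned by `((z+1)², (z+2)², (z+4)²)` has
free distance `9`. -/
theorem free_distance_F5_code_one_row :
    IsLeast
      { w : ℕ | ∃ u : Fin 3 → Polynomial (ZMod 5), u ≠ 0 ∧
          (fun i => algebraMap (Polynomial (ZMod 5)) (RatFunc (ZMod 5)) (u i)) ∈
            Submodule.span (RatFunc (ZMod 5))
              ({fun i => algebraMap (Polynomial (ZMod 5)) (RatFunc (ZMod 5))
                  (![(X + 1) ^ 2, (X + 2) ^ 2, (X + 4) ^ 2] i)} :
                Set (Fin 3 → RatFunc (ZMod 5))) ∧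
          w = ∑ i, (u i).support.card }
      9 := by
  constructor
  · refine ⟨![(X + 1) ^ 2, (X + 2) ^ 2, (X + 4) ^ 2], fun h => ?_,
      Submodule.mem_span_singleton_self _, ?_⟩
    · exact pow_ne_zero 2 (X_add_C_ne_zero (1 : ZMod 5)) (by simpa using congrFun h 0)
    · rw [generator_eq, Fin.sum_univ_three]
      simp only [Matrix.cons_val]
      rw [card_support_monic_quadratic (by decide) (by decide),
        card_support_monic_quadratic (by decide) (by decide),
        card_support_monic_quadratic (by decide) (by decide)]
  · rintro w ⟨u, hu, hmem, rfl⟩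
    obtain ⟨r, hr⟩ := Submodule.mem_span_singleton.mp hmem
    have hcop : IsCoprime ((![(X + 1) ^ 2, (X + 2) ^ 2, (X + 4) ^ 2] : Fin 3 → (ZMod 5)[X]) 0)
        ((![(X + 1) ^ 2, (X + 2) ^ 2, (X + 4) ^ 2] : Fin 3 → (ZMod 5)[X]) 1) :=
      IsCoprime.pow ⟨-1, 1, by ring⟩
    obtain ⟨p, hp⟩ := exists_eq_mul_of_isCoprime _ u hcop fun k => congrFun hr k
    simp only [hp]
    refine nine_le_weight_mul p ?_
    rintro rfl
    exact hu (funext fun k => by simp [hp])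
end

section
/- Let F₅ = ℤ/5ℤ and let C ⊆ F₅(z)⁴ be the F₅(z)-linear span of the two row vectors (z+1, 2z+3, 4z+4, 3z+2) and ((z+1)², (2z+3)², (4z+4)², (3z+2)²). Then the free distance of C equals 8; that is, 8 is the least element of the set of weights of nonzero codewords of C all of whose components are polynomials. -/
open Polynomial

namespace ConvolutionalF5

/-- The slopes `a` of the linear forms `a z + b` generating the code. -/
def slopes : Fin 4 → ZMod 5 := ![1, 2, 4, 3]

/-- The constant terms `b` of the linear forms `a z + b` generating the code. -/
def intercepts : Fin 4 → ZMod 5 := ![1, 3, 4, 2]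

/-- The output symbol of the encoder in state `(a, b, c)`, the previous coefficient of the first
input and the two previous coefficients of the second one, on reading `(x, y)`. -/
def branch (a b c x y : ZMod 5) (i : Fin 4) : ZMod 5 :=
  intercepts i * x + slopes i * a +
    (intercepts i ^ 2 * y + 2 * slopes i * intercepts i * b + slopes i ^ 2 * c)

/-- The number of nonzero output symbols of the encoder. -/
def branchWeight (a b c x y : ZMod 5) : ℕ :=
  ∑ i, if branch a b c x y i ≠ 0 then 1 else 0

/-- The distance from an encoder state to the zero state in the weighted state diagram,
read off from a table of decimal digits. -/
def stateDist (a b c : ZMod 5) : ℕ :=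
  65465566454665564565333346456546655566456546533334645654665556645654653333465465566454665564565333345665665566655665665644440
    / 10 ^ (25 * a.val + 5 * b.val + c.val) % 10

theorem stateDist_zero : stateDist 0 0 0 = 0 := by
  decide +kernel

theorem stateDist_le (a b c x y : ZMod 5) :
    stateDist a b c ≤ branchWeight a b c x y + stateDist x y b := by
  revert a b c x y
  decide +kernel

theorem eight_le_branchWeight_add (x y : ZMod 5) (h : x ≠ 0 ∨ y ≠ 0) :
    8 ≤ branchWeight 0 0 0 x y + stateDist x y 0 := by
  revert x y
  decide +kernel

/-- Along any input started in the zero state, either nothing has been read yet or the weight so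
far plus the distance back to the zero state is at least `8`. -/
theorem eight_le_sum_branchWeight_add (p q : ℕ → ZMod 5) (hp₀ : p 0 = 0) (hp₁ : p 1 = 0)
    (hq₀ : q 0 = 0) (hq₁ : q 1 = 0) (N : ℕ) :
    (∀ k < N + 2, p k = 0 ∧ q k = 0) ∨
      8 ≤ ∑ n ∈ Finset.range N, branchWeight (p (n + 1)) (q (n + 1)) (q n) (p (n + 2)) (q (n + 2))
        + stateDist (p (N + 1)) (q (N + 1)) (q N) := by
  induction N with
  | zero =>
    left
    intro k hk
    interval_cases k
    exacts [⟨hp₀, hq₀⟩, ⟨hp₁, hq₁⟩]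
  | succ N ih =>
    rw [Finset.sum_range_succ]
    rcases ih with h | h
    · by_cases hx : p (N + 2) = 0 ∧ q (N + 2) = 0
      · left
        intro k hk
        rcases Nat.lt_succ_iff_lt_or_eq.mp hk with hk | rfl
        exacts [h k hk, hx]
      · right
        have key := eight_le_branchWeight_add (p (N + 2)) (q (N + 2)) (by tauto)
        rw [(h (N + 1) (by omega)).1, (h (N + 1) (by omega)).2, (h N (by omega)).2, add_assoc]
        exact key.trans (Nat.le_add_left _ _)
    · right
      have key := stateDist_le (p (N + 1)) (q (N + 1)) (q N) (p (N + 2)) (q (N + 2))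
      rw [add_assoc]
      exact h.trans (Nat.add_le_add_left key _)

/-- The linear forms generating the code. -/
noncomputable def form (i : Fin 4) : (ZMod 5)[X] := C (slopes i) * X + C (intercepts i)

theorem coeff_encode (p q : (ZMod 5)[X]) (i : Fin 4) (n : ℕ) :
    (p * form i + q * form i ^ 2).coeff (n + 2) =
      branch (p.coeff (n + 1)) (q.coeff (n + 1)) (q.coeff n) (p.coeff (n + 2)) (q.coeff (n + 2))
        i := by
  have h : p * form i + q * form i ^ 2 =
      C (intercepts i) * p + C (slopes i) * (p * X) + (C (intercepts i ^ 2) * q +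
        C (2 * slopes i * intercepts i) * (q * X) + C (slopes i ^ 2) * (q * X * X)) := by
    simp only [form, C_mul, C_pow, C_ofNat]
    ring
  rw [h]
  simp only [coeff_add, coeff_C_mul, coeff_mul_X, branch]

theorem sum_branchWeight_le (p q : (ZMod 5)[X]) (N : ℕ) :
    ∑ n ∈ Finset.range N, branchWeight ((p * X ^ 2).coeff (n + 1)) ((q * X ^ 2).coeff (n + 1))
      ((q * X ^ 2).coeff n) ((p * X ^ 2).coeff (n + 2)) ((q * X ^ 2).coeff (n + 2)) ≤
      ∑ i, (p * form i + q * form i ^ 2).support.card := by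
  simp only [branchWeight]
  rw [Finset.sum_comm]
  refine Finset.sum_le_sum fun i _ => ?_
  rw [← Finset.card_filter]
  refine Finset.card_le_card fun n hn => ?_
  rw [Finset.mem_filter, ← coeff_encode] at hn
  have h : p * X ^ 2 * form i + q * X ^ 2 * form i ^ 2 =
      (p * form i + q * form i ^ 2) * X ^ 2 := by ring
  rw [h, coeff_mul_X_pow] at hn
  exact mem_support_iff.mpr hn.2

theorem eight_le_weight_encode (p q : (ZMod 5)[X]) (h : p ≠ 0 ∨ q ≠ 0) :
    8 ≤ ∑ i, (p * form i + q * form i ^ 2).support.card := by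
  set N := p.natDegree + q.natDegree + 3 with hN
  have hp (k : ℕ) (hk : p.natDegree + 2 < k) : (p * X ^ 2).coeff k = 0 := by
    rw [coeff_mul_X_pow', if_pos (by omega)]
    exact coeff_eq_zero_of_natDegree_lt (by omega)
  have hq (k : ℕ) (hk : q.natDegree + 2 < k) : (q * X ^ 2).coeff k = 0 := by
    rw [coeff_mul_X_pow', if_pos (by omega)]
    exact coeff_eq_zero_of_natDegree_lt (by omega)
  rcases eight_le_sum_branchWeight_add (p * X ^ 2).coeff (q * X ^ 2).coeff
      (by simp) (by simp [coeff_mul_X_pow']) (by simp) (by simp [coeff_mul_X_pow']) N with h₀ | h₈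
  · exfalso
    rcases h with h | h
    · refine h (leadingCoeff_eq_zero.mp ?_)
      have := (h₀ (p.natDegree + 2) (by omega)).1
      rwa [coeff_mul_X_pow] at this
    · refine h (leadingCoeff_eq_zero.mp ?_)
      have := (h₀ (q.natDegree + 2) (by omega)).2
      rwa [coeff_mul_X_pow] at this
  · rw [hp (N + 1) (by omega), hq (N + 1) (by omega), hq N (by omega), stateDist_zero] at h₈
    exact h₈.trans (sum_branchWeight_le p q N)

theorem form_eq : form = ![X + 1, 2 * X + 3, 4 * X + 4, 3 * X + 2] := by
  funext i
  fin_cases i <;> simp [form, slopes, intercepts, C_ofNat]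

theorem cast_five_eq_zero : (5 : RatFunc (ZMod 5)) = 0 := by
  have := congrArg (algebraMap (ZMod 5) (RatFunc (ZMod 5))) (show (5 : ZMod 5) = 0 from rfl)
  rwa [map_ofNat, map_zero] at this

/-- Polynomial codewords have polynomial messages: the generator matrix is basic. -/
theorem exists_message (u : Fin 4 → (ZMod 5)[X]) (c d : RatFunc (ZMod 5))
    (h : ∀ i, algebraMap (ZMod 5)[X] (RatFunc (ZMod 5)) (u i) =
      c * algebraMap (ZMod 5)[X] (RatFunc (ZMod 5)) (form i) +
        d * algebraMap (ZMod 5)[X] (RatFunc (ZMod 5)) (form i) ^ 2) :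
    ∃ p q : (ZMod 5)[X], ∀ i, u i = p * form i + q * form i ^ 2 := by
  have h₅ := cast_five_eq_zero
  obtain ⟨p, hp⟩ : ∃ p : (ZMod 5)[X], algebraMap (ZMod 5)[X] (RatFunc (ZMod 5)) p = c := by
    refine ⟨2 * (4 * (u 1 - u 3) - 3 * (u 0 - u 2)), ?_⟩
    simp only [map_mul, map_sub, map_ofNat, h]
    simp only [form_eq, Matrix.cons_val, map_add, map_mul, map_ofNat, map_one,
      RatFunc.algebraMap_X]
    linear_combination
      (c * (2 * RatFunc.X + 5) + d * (10 * RatFunc.X ^ 2 + 36 * RatFunc.X + 26)) * h₅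
  obtain ⟨q, hq⟩ : ∃ q : (ZMod 5)[X], algebraMap (ZMod 5)[X] (RatFunc (ZMod 5)) q = d := by
    refine ⟨8 * ((X + 4 - 3 * (X + 1)) * (2 * (u 1 + u 3)) +
      (3 * (X + 4) - (X + 1)) * (3 * (u 0 + u 2))), ?_⟩
    simp only [map_mul, map_add, map_sub, map_ofNat, h]
    simp only [form_eq, Matrix.cons_val, map_add, map_mul, map_ofNat, map_one,
      RatFunc.algebraMap_X]
    linear_combination
      (c * (16 * RatFunc.X ^ 2 + 296 * RatFunc.X + 280) +
        d * (80 * RatFunc.X ^ 3 + 1112 * RatFunc.X ^ 2 + 1952 * RatFunc.X + 939)) * h₅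
  refine ⟨p, q, fun i => IsFractionRing.injective _ (RatFunc (ZMod 5)) ?_⟩
  simp only [h, map_add, map_mul, map_pow, hp, hq]

end ConvolutionalF5

open ConvolutionalF5

/-- The convolutional code over `F₅(z)` spanned by `(z+1, 2z+3, 4z+4, 3z+2)` and
`((z+1)², (2z+3)², (4z+4)², (3z+2)²)` has free distance `8`. -/
theorem free_distance_F5_code_two_rows :
    IsLeast
      { w : ℕ | ∃ u : Fin 4 → Polynomial (ZMod 5), u ≠ 0 ∧
          (fun i => algebraMap (Polynomial (ZMod 5)) (RatFunc (ZMod 5)) (u i)) ∈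
            Submodule.span (RatFunc (ZMod 5))
              ({fun i => algebraMap (Polynomial (ZMod 5)) (RatFunc (ZMod 5))
                  (![X + 1, C 2 * X + 3, C 4 * X + 4, C 3 * X + 2] i),
                fun i => algebraMap (Polynomial (ZMod 5)) (RatFunc (ZMod 5))
                  (![(X + 1) ^ 2, (C 2 * X + 3) ^ 2, (C 4 * X + 4) ^ 2,
                     (C 3 * X + 2) ^ 2] i)} :
                Set (Fin 4 → RatFunc (ZMod 5))) ∧
          w = ∑ i, (u i).support.card }
      8 := by
  have hform : ![X + 1, C 2 * X + 3, C 4 * X + 4, C 3 * X + 2] = form := by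
    simp only [form_eq, C_ofNat]
  have hform_sq : ![(X + 1) ^ 2, (C 2 * X + 3) ^ 2, (C 4 * X + 4) ^ 2, (C 3 * X + 2) ^ 2] =
      fun i => form i ^ 2 := by
    rw [← hform]
    funext i
    fin_cases i <;> rfl
  rw [hform, hform_sq]
  constructor
  · refine ⟨form, fun h => ?_, Submodule.subset_span (Or.inl rfl), ?_⟩
    · have := congrArg (fun p => coeff p 0) (congrFun h 0)
      simp [form, intercepts] at this
    · have hcard (i : Fin 4) : (form i).support.card = 2 := by
        have hs : slopes i ≠ 0 := by revert i; decide
        have hi : intercepts i ≠ 0 := by revert i; decide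
        have := card_support_binomial (k := 1) (m := 0) one_ne_zero hs hi
        simpa [form] using this
      simp [hcard]
  · rintro w ⟨u, hu, hmem, rfl⟩
    obtain ⟨c, d, hcd⟩ := Submodule.mem_span_pair.mp hmem
    obtain ⟨p, q, hpq⟩ := exists_message u c d fun i => by
      simpa using (congrFun hcd i).symm
    simp only [hpq]
    refine eight_le_weight_encode p q ?_
    by_contra! h
    exact hu (funext fun i => by simp [hpq, h.1, h.2])
end

section
/- Let F₂ = ℤ/2ℤ and let C ⊆ F₂(z)³ be the F₂(z)-linear span of the two row vectors (1, 1, 1) and (z²+z, 0, z). Then the free distance of C equals 2; that is, 2 is the least element of the set of weights of nonzero codewords of C all of whose components are polynomials. -/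
open Polynomial

theorem ratFunc_one_add_one : (1 : RatFunc (ZMod 2)) + 1 = 0 := by
  have h : (1 : Polynomial (ZMod 2)) + 1 = 0 := CharTwo.add_self_eq_zero 1
  simpa using congrArg (algebraMap (Polynomial (ZMod 2)) (RatFunc (ZMod 2))) h

/-- `(1, z, z + 1)` is a parity check for the code spanned by `(1, 1, 1)` and `(z² + z, 0, z)`. -/
theorem parity_check_of_mem_span {u : Fin 3 → Polynomial (ZMod 2)}
    (hu : (fun i => algebraMap (Polynomial (ZMod 2)) (RatFunc (ZMod 2)) (u i)) ∈
      Submodule.span (RatFunc (ZMod 2))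
        ({fun i => algebraMap (Polynomial (ZMod 2)) (RatFunc (ZMod 2)) (![1, 1, 1] i),
          fun i => algebraMap (Polynomial (ZMod 2)) (RatFunc (ZMod 2))
            (![X ^ 2 + X, 0, X] i)} : Set (Fin 3 → RatFunc (ZMod 2)))) :
    u 0 + X * u 1 + (X + 1) * u 2 = 0 := by
  obtain ⟨a, b, h⟩ := Submodule.mem_span_pair.mp hu
  have h0 := congrFun h 0
  have h1 := congrFun h 1
  have h2 := congrFun h 2
  simp at h0 h1 h2
  apply IsFractionRing.injective (Polynomial (ZMod 2)) (RatFunc (ZMod 2))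
  simp only [map_add, map_mul, map_one, map_zero, RatFunc.algebraMap_X]
  rw [← h0, ← h1, ← h2]
  linear_combination (a * (RatFunc.X + 1) + b * (RatFunc.X ^ 2 + RatFunc.X)) *
    ratFunc_one_add_one

/-- The convolutional code over `F₂(z)` spanned by `(1, 1, 1)` and `(z²+z, 0, z)`
(the Goppa code of an elliptic curve over `F₂(z)`) has free distance `2`. -/
theorem free_distance_elliptic_code_three_points :
    IsLeast
      { w : ℕ | ∃ u : Fin 3 → Polynomial (ZMod 2), u ≠ 0 ∧
          (fun i => algebraMap (Polynomial (ZMod 2)) (RatFunc (ZMod 2)) (u i)) ∈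
            Submodule.span (RatFunc (ZMod 2))
              ({fun i => algebraMap (Polynomial (ZMod 2)) (RatFunc (ZMod 2))
                  (![1, 1, 1] i),
                fun i => algebraMap (Polynomial (ZMod 2)) (RatFunc (ZMod 2))
                  (![X ^ 2 + X, 0, X] i)} :
                Set (Fin 3 → RatFunc (ZMod 2))) ∧
          w = ∑ i, (u i).support.card }
      2 := by
  constructor
  · refine ⟨![X, 1, 0], fun h => one_ne_zero (congrFun h 1), ?_, ?_⟩
    · refine Submodule.mem_span_pair.mpr ⟨1, RatFunc.X⁻¹, ?_⟩
      have hX : (RatFunc.X : RatFunc (ZMod 2)) ≠ 0 := RatFunc.X_ne_zero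
      funext i
      fin_cases i
      · simp
        field_simp
        linear_combination ratFunc_one_add_one
      · simp
      · simp [hX, ratFunc_one_add_one]
    · have h1 : (1 : Polynomial (ZMod 2)).support.card = 1 := by
        rw [← C_1, support_C one_ne_zero]; rfl
      simp [Fin.sum_univ_three, h1]
  · rintro w ⟨u, hu, hmem, rfl⟩
    have hpar := parity_check_of_mem_span hmem
    have hX1 : (X + 1 : Polynomial (ZMod 2)) ≠ 0 := X_add_C_ne_zero 1
    have hzero (i) : (u i).support.card = 0 → u i = 0 := by simp
    by_contra! hlt
    rw [Fin.sum_univ_three] at hlt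
    apply hu
    have hcases : (u 0 = 0 ∧ u 1 = 0) ∨ (u 0 = 0 ∧ u 2 = 0) ∨ (u 1 = 0 ∧ u 2 = 0) := by
      have := hzero 0
      have := hzero 1
      have := hzero 2
      by_contra!
      grind
    funext i
    rcases hcases with ⟨h, h'⟩ | ⟨h, h'⟩ | ⟨h, h'⟩ <;>
      fin_cases i <;> simp_all
end

section
/- Let F₂ = ℤ/2ℤ and let C ⊆ F₂(z)⁵ be the F₂(z)-linear span of the two row vectors (1, 1, 1, 1, 1) and (z³+z², 0, z³+z², z²+z, z²+z). Then the free distance of C equals 4; that is, 4 is the least element of the set of weights of nonzero codewords of C all of whose components are polynomials. -/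
open Polynomial

/-- Over `F₂`, the value of a polynomial at `1` is the parity of its weight. -/
theorem eval_one_eq_card_support (p : (ZMod 2)[X]) :
    p.eval 1 = (p.support.card : ZMod 2) := by
  have h : ∀ c : ZMod 2, c ≠ 0 → c = 1 := by decide
  rw [eval_eq_sum, Polynomial.sum, Finset.sum_congr rfl fun i hi => by
    rw [one_pow, mul_one, h _ (mem_support_iff.mp hi)]]
  simp

/-- A nonzero triple satisfying `p - q = X (r - q)` over `F₂` has weight at least two in the
components `p` and `r` together. -/
theorem two_le_card_support_add_card_support {p q r : (ZMod 2)[X]}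
    (h : p - q = X * (r - q)) (h0 : ¬(p = 0 ∧ q = 0 ∧ r = 0)) :
    2 ≤ p.support.card + r.support.card := by
  have h1 : p.eval 1 = r.eval 1 := by
    have := congrArg (eval 1) h
    simpa using this
  rw [eval_one_eq_card_support, eval_one_eq_card_support, ZMod.natCast_eq_natCast_iff'] at h1
  by_contra! hlt
  have hp : p = 0 := by rw [← card_support_eq_zero]; omega
  have hr : r = 0 := by rw [← card_support_eq_zero]; omega
  subst hp hr
  have hq : (X - C 1) * q = 0 := by
    rw [C_1]
    linear_combination h
  exact h0 ⟨rfl, (mul_eq_zero.mp hq).resolve_left (X_sub_C_ne_zero 1), rfl⟩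

/-- The convolutional code over `F₂(z)` spanned by `(1, 1, 1, 1, 1)` and
`(z³+z², 0, z³+z², z²+z, z²+z)` (the Goppa code of an elliptic curve over `F₂(z)`)
has free distance `4`. -/
theorem free_distance_elliptic_code_five_points :
    IsLeast
      { w : ℕ | ∃ u : Fin 5 → Polynomial (ZMod 2), u ≠ 0 ∧
          (fun i => algebraMap (Polynomial (ZMod 2)) (RatFunc (ZMod 2)) (u i)) ∈
            Submodule.span (RatFunc (ZMod 2))
              ({fun i => algebraMap (Polynomial (ZMod 2)) (RatFunc (ZMod 2))
                  (![1, 1, 1, 1, 1] i),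
                fun i => algebraMap (Polynomial (ZMod 2)) (RatFunc (ZMod 2))
                  (![X ^ 3 + X ^ 2, 0, X ^ 3 + X ^ 2, X ^ 2 + X, X ^ 2 + X] i)} :
                Set (Fin 5 → RatFunc (ZMod 2))) ∧
          w = ∑ i, (u i).support.card }
      4 := by
  have hinj := RatFunc.algebraMap_injective (ZMod 2)
  constructor
  · refine ⟨![X, 0, X, 1, 1], fun h => one_ne_zero (congrFun h 3), ?_, ?_⟩
    · have hne : (RatFunc.X ^ 2 + RatFunc.X : RatFunc (ZMod 2)) ≠ 0 := by
        have h : (X ^ 2 + X : (ZMod 2)[X]) ≠ 0 := fun h => by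
          have := congrArg (coeff · 1) h
          simp [coeff_X_pow] at this
        simpa using hinj.ne h
      rw [Submodule.mem_span_pair]
      refine ⟨0, (RatFunc.X ^ 2 + RatFunc.X)⁻¹, ?_⟩
      ext i
      fin_cases i <;> simp [inv_mul_eq_iff_eq_mul₀ hne] <;> ring
    · simp [Fin.sum_univ_five, support_X, ← C_1, support_C, -map_one]
  · rintro w ⟨u, hu, hmem, rfl⟩
    obtain ⟨a, b, hab⟩ := Submodule.mem_span_pair.mp hmem
    have e := congrFun hab
    have e0 := e 0
    have e1 := e 1
    have e2 := e 2
    have e3 := e 3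
    have e4 := e 4
    simp at e0 e1 e2 e3 e4
    have h20 : u 2 = u 0 := hinj (e2.symm.trans e0)
    have h43 : u 4 = u 3 := hinj (e4.symm.trans e3)
    have hrel : u 0 - u 1 = X * (u 3 - u 1) := hinj (by
      simp only [map_sub, map_mul, RatFunc.algebraMap_X, ← e0, ← e1, ← e3]
      ring)
    have := two_le_card_support_add_card_support hrel fun ⟨h0, h1, h3⟩ => hu <| by
      ext1 i
      fin_cases i <;> simp [h20, h43, h0, h1, h3]
    rw [Fin.sum_univ_five, h20, h43]
    omega
end
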